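/- Let H be a nontrivial complex Hilbert space and T : H → H a bounded normal operator (T*T = TT*). Then m(T) = d(0, σ(T)), i.e., inf{‖Tx‖ : ‖x‖ = 1} = inf{|λ| : λ ∈ σ(T)}. -/

import Mathlib

open ContinuousLinearMap

variable {H : Type*} [NormedAddCommGroup H] [InnerProductSpace ℂ H] [CompleteSpace H]

/-- The minimum modulus of a bounded operator. -/
noncomputable def mB (T : H →L[ℂ] H) : ℝ :=
  sInf {r : ℝ | ∃ x : H, ‖x‖ = 1 ∧ ‖T x‖ = r}

omit [CompleteSpace H] in
lemma mB_le_norm_apply (T : H →L[ℂ] H) {x : H} (hx : ‖x‖ = 1) : mB T ≤ ‖T x‖ :=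
  csInf_le ⟨0, by rintro _ ⟨y, -, rfl⟩; exact norm_nonneg _⟩ ⟨x, hx, rfl⟩

omit [CompleteSpace H] in
lemma mB_mul_norm_le (T : H →L[ℂ] H) (x : H) : mB T * ‖x‖ ≤ ‖T x‖ := by
  rcases eq_or_ne x 0 with rfl | hx
  · simp
  have h := mB_le_norm_apply T (norm_smul_inv_norm (𝕜 := ℂ) hx)
  rw [map_smul, norm_smul, norm_inv, RCLike.norm_ofReal, abs_norm, inv_mul_eq_div] at h
  rwa [le_div_iff₀ (norm_pos_iff.mpr hx)] at h

/-- A normal operator that is bounded below is invertible. -/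
lemma IsStarNormal.isUnit_of_mul_norm_le {T : H →L[ℂ] H} (hT : IsStarNormal T) {c : ℝ}
    (hc : 0 < c) (h : ∀ x, c * ‖x‖ ≤ ‖T x‖) : IsUnit T := by
  have hanti : AntilipschitzWith (Real.toNNReal c⁻¹) T := by
    refine T.antilipschitz_of_bound fun x ↦ ?_
    rw [Real.coe_toNNReal _ (inv_nonneg.mpr hc.le), inv_mul_eq_div, le_div_iff₀ hc, mul_comm]
    exact h x
  rw [isUnit_iff_bijective, bijective_iff_dense_range_and_antilipschitz]
  refine ⟨?_, _, hanti⟩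
  rw [Submodule.topologicalClosure_eq_top_iff, ContinuousLinearMap.IsStarNormal.orthogonal_range hT]
  exact LinearMap.ker_eq_bot.mpr hanti.injective

lemma IsStarNormal.mB_le_norm_of_mem_spectrum {T : H →L[ℂ] H} (hT : IsStarNormal T) {z : ℂ}
    (hz : z ∈ spectrum ℂ T) : mB T ≤ ‖z‖ := by
  by_contra! hlt
  have hN : IsStarNormal (algebraMap ℂ (H →L[ℂ] H) z - T) :=
    have : IsStarNormal (algebraMap ℂ (H →L[ℂ] H) z) := ⟨Algebra.commute_algebraMap_right z _⟩
    (Algebra.commute_algebraMap_left z (star T)).isStarNormal_sub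
  refine hz (hN.isUnit_of_mul_norm_le (sub_pos.mpr hlt) fun x ↦ ?_)
  have h₁ := mB_mul_norm_le T x
  have h₂ := norm_sub_norm_le (T x) (z • x)
  rw [norm_smul, norm_sub_rev] at h₂
  simp only [Algebra.algebraMap_eq_smul_one, sub_apply, smul_apply, one_apply_eq_self]
  linarith

/-- A normal operator whose spectrum avoids the open ball of radius `d` is bounded below by `d`. -/
lemma IsStarNormal.mul_norm_le_norm_apply [Nontrivial H] {T : H →L[ℂ] H} (hT : IsStarNormal T)
    {d : ℝ} (hd : ∀ z ∈ spectrum ℂ T, d ≤ ‖z‖) (x : H) : d * ‖x‖ ≤ ‖T x‖ := by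
  rcases le_or_gt d 0 with hd₀ | hd₀
  · exact (mul_nonpos_of_nonpos_of_nonneg hd₀ (norm_nonneg x)).trans (norm_nonneg _)
  have hunit : IsUnit T := by
    by_contra h
    simpa [hd₀.not_ge] using hd 0 (spectrum.zero_mem ℂ h)
  obtain ⟨u, rfl⟩ := hunit
  obtain ⟨w, hw, hwn⟩ := spectrum.exists_nnnorm_eq_spectralRadius (↑u⁻¹ : H →L[ℂ] H)
  have hN : IsStarNormal (↑u⁻¹ : H →L[ℂ] H) := IsStarNormal.val_inv
  rw [hN.spectralRadius_eq_nnnorm, ENNReal.coe_inj] at hwn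
  have hwn' : ‖w‖ = ‖(↑u⁻¹ : H →L[ℂ] H)‖ := congrArg NNReal.toReal hwn
  have hdw := hd _ (spectrum.inv₀_mem_iff.mpr hw)
  have hx : ‖x‖ ≤ ‖w‖ * ‖(u : H →L[ℂ] H) x‖ := by
    rw [hwn']
    calc ‖x‖ = ‖(↑u⁻¹ * ↑u : H →L[ℂ] H) x‖ := by simp
      _ ≤ _ := (↑u⁻¹ : H →L[ℂ] H).le_opNorm _
  have hw₀ : 0 < ‖w‖ := inv_pos.mp (by simpa using hd₀.trans_le hdw)
  calc d * ‖x‖ ≤ ‖w‖⁻¹ * (‖w‖ * ‖(u : H →L[ℂ] H) x‖) := by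
        rw [norm_inv] at hdw
        gcongr
    _ = ‖(u : H →L[ℂ] H) x‖ := inv_mul_cancel_left₀ hw₀.ne' _

theorem min_modulus_eq_dist_spectrum_of_normal [Nontrivial H] (T : H →L[ℂ] H)
    (hT : adjoint T ∘L T = T ∘L adjoint T) :
    mB T = sInf {r : ℝ | ∃ z ∈ spectrum ℂ T, ‖z‖ = r} := by
  have hN : IsStarNormal T := ⟨hT⟩
  apply le_antisymm
  · obtain ⟨z, hz⟩ := spectrum.nonempty T
    refine le_csInf ⟨‖z‖, z, hz, rfl⟩ ?_
    rintro _ ⟨w, hw, rfl⟩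
    exact hN.mB_le_norm_of_mem_spectrum hw
  · obtain ⟨x, hx⟩ := exists_norm_eq H zero_le_one
    refine le_csInf ⟨‖T x‖, x, hx, rfl⟩ ?_
    rintro _ ⟨y, hy, rfl⟩
    have h := hN.mul_norm_le_norm_apply (d := sInf {r : ℝ | ∃ z ∈ spectrum ℂ T, ‖z‖ = r})
      (fun z hz ↦ csInf_le ⟨0, by rintro _ ⟨w, -, rfl⟩; exact norm_nonneg _⟩ ⟨z, hz, rfl⟩) y
    rwa [hy, mul_one] at h
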